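/- Let n ≥ 1 and m ≥ 1 be integers and let a_1, …, a_n be positive integers with a_1 + ⋯ + a_n ≤ m. Then a_1 · a_2 ⋯ a_n ≤ 1.3211^{m+n}. -/

import Mathlib

theorem natCast_le_pow_succ (k : ℕ) : (k : ℝ) ≤ 1.3211 ^ (k + 1) := by
  rcases lt_or_ge k 4 with hk | hk
  · interval_cases k <;> norm_num
  · induction k, hk using Nat.le_induction with
    | base => norm_num
    | succ k hk ih =>
      have hk' : (4 : ℝ) ≤ k := by exact_mod_cast hk
      rw [pow_succ]
      push_cast
      linarith

/-- Let `n ≥ 1`, `m ≥ 1` and `a₁, …, aₙ` positive integers with `∑ aᵢ ≤ m`.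
Then `∏ aᵢ ≤ 1.3211 ^ (m + n)`. -/
theorem prod_le_pow_of_sum_le (n m : ℕ) (hn : 1 ≤ n) (hm : 1 ≤ m)
    (a : Fin n → ℕ) (ha : ∀ i, 1 ≤ a i) (hsum : ∑ i, a i ≤ m) :
    ((∏ i, a i : ℕ) : ℝ) ≤ 1.3211 ^ (m + n) := by
  calc ((∏ i, a i : ℕ) : ℝ) = ∏ i, (a i : ℝ) := by push_cast; rfl
    _ ≤ ∏ i, (1.3211 : ℝ) ^ (a i + 1) :=
      Finset.prod_le_prod (fun i _ => Nat.cast_nonneg _) fun i _ => natCast_le_pow_succ (a i)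
    _ = 1.3211 ^ (∑ i, a i + n) := by
      rw [Finset.prod_pow_eq_pow_sum, Finset.sum_add_distrib]
      simp
    _ ≤ 1.3211 ^ (m + n) := pow_le_pow_right₀ (by norm_num) (by lia)
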